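/- Assume (A3). Let r ∈ P ∖ p̄ and let L be the unique circle of the pencil ⟨p,K⟩ containing r. Then: (i) every σ ∈ Δ with σ(r) = r maps every circle of the pencil ⟨r,L⟩ onto itself; (ii) for every circle M ∈ ⟨r,L⟩ and all x, y ∈ M ∖ {r, pM} there is σ ∈ Δ with σ(r) = r and σ(x) = y; (iii) there is an involution σ ∈ Δ with σ(r) = r which fixes every point of r̄ and every point of p̄ and maps K onto itself. -/

import Mathlib

/-- A Laguerre plane: points, circles, and a parallelity relation. -/
structure LaguerrePlane (P : Type*) where
  Circles : Set (Set P)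
  Par : P → P → Prop
  par_equiv : Equivalence Par
  joinCircle : ∀ a b c : P, ¬ Par a b → ¬ Par b c → ¬ Par a c →
    ∃! C, C ∈ Circles ∧ a ∈ C ∧ b ∈ C ∧ c ∈ C
  touching : ∀ K ∈ Circles, ∀ p ∈ K, ∀ q, q ∉ K → ¬ Par p q →
    ∃! C, C ∈ Circles ∧ q ∈ C ∧ K ∩ C = {p}
  parPoint : ∀ (x : P), ∀ K ∈ Circles, ∃! q, Par x q ∧ q ∈ K
  nontriv : ∃ C ∈ Circles,
    (∃ a b c : P, a ∈ C ∧ b ∈ C ∧ c ∈ C ∧ a ≠ b ∧ b ≠ c ∧ a ≠ c) ∧ C ≠ Set.univ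

namespace LaguerrePlane

variable {P : Type*}

/-- The generator (parallel class) of a point. -/
def gen (L : LaguerrePlane P) (p : P) : Set P := {q | L.Par p q}

/-- The pencil ⟨p,K⟩: the circle K together with all circles tangent to K at p. -/
def pencil (L : LaguerrePlane P) (p : P) (K : Set P) : Set (Set P) :=
  insert K {M | M ∈ L.Circles ∧ M ∩ K = {p}}

/-- An automorphism of a Laguerre plane: a bijection of the points mapping
circles onto circles and preserving parallelity. -/
def IsAut (L : LaguerrePlane P) (σ : Equiv.Perm P) : Prop :=
  (∀ C, C ∈ L.Circles ↔ ⇑σ '' C ∈ L.Circles) ∧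
  (∀ x y, L.Par x y ↔ L.Par (σ x) (σ y))

/-- The line x ⊔ y of the residual plane SA(p,K):
{x} together with the orbit of y under the stabilizer of x in Δ. -/
def line (Δ : Subgroup (Equiv.Perm P)) (x y : P) : Set P :=
  {x} ∪ {z | ∃ σ ∈ Δ, σ x = x ∧ σ y = z}

/-- Parallelity of lines of the residual plane SA(p,K). -/
def LinePar (Δ : Subgroup (Equiv.Perm P)) (A B : Set P) : Prop :=
  ∃ σ ∈ Δ, ⇑σ '' A = B

end LaguerrePlane

open LaguerrePlane

namespace LaguerrePlane

variable {P : Type*} (L : LaguerrePlane P)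

theorem par_refl (a : P) : L.Par a a := L.par_equiv.refl a

variable {L}

theorem Par.symm {a b : P} (h : L.Par a b) : L.Par b a := L.par_equiv.symm h

theorem Par.trans {a b c : P} (h : L.Par a b) (h' : L.Par b c) : L.Par a c :=
  L.par_equiv.trans h h'

theorem eq_of_par {C : Set P} (hC : C ∈ L.Circles) {a b : P} (ha : a ∈ C) (hb : b ∈ C)
    (h : L.Par a b) : a = b :=
  (L.parPoint a C hC).unique ⟨L.par_refl a, ha⟩ ⟨h, hb⟩

theorem eq_of_three {C D : Set P} (hC : C ∈ L.Circles) (hD : D ∈ L.Circles) {a b c : P}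
    (ha : a ∈ C) (hb : b ∈ C) (hc : c ∈ C) (ha' : a ∈ D) (hb' : b ∈ D) (hc' : c ∈ D)
    (hab : a ≠ b) (hbc : b ≠ c) (hac : a ≠ c) : C = D :=
  (L.joinCircle a b c (fun h => hab (eq_of_par hC ha hb h)) (fun h => hbc (eq_of_par hC hb hc h))
    (fun h => hac (eq_of_par hC ha hc h))).unique ⟨hC, ha, hb, hc⟩ ⟨hD, ha', hb', hc'⟩

variable (L)

theorem exists_not_par_not_par (a b : P) : ∃ c, ¬ L.Par a c ∧ ¬ L.Par b c := by
  obtain ⟨C, hC, ⟨x, y, z, hx, hy, hz, hxy, hyz, hxz⟩, -⟩ := L.nontriv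
  by_contra! H
  have key : ∀ d u v, u ∈ C → v ∈ C → u ≠ v → L.Par d u → ¬ L.Par d v :=
    fun d u v hu hv huv h h' => huv (eq_of_par hC hu hv (h.symm.trans h'))
  by_cases hax : L.Par a x
  · have hby := H y (key a x y hx hy hxy hax)
    exact key b y z hy hz hyz hby (H z (key a x z hx hz hxz hax))
  · have hbx := H x hax
    have not_b : ∀ w, ¬ L.Par b w → L.Par a w := fun w hw => not_imp_comm.1 (H w) hw
    have hay := not_b y (key b x y hx hy hxy hbx)
    exact key a y z hy hz hyz hay (not_b z (key b x z hx hz hxz hbx))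

theorem exists_circle_mem (x : P) : ∃ C ∈ L.Circles, x ∈ C := by
  obtain ⟨c, hc, -⟩ := L.exists_not_par_not_par x x
  obtain ⟨d, hd, hd'⟩ := L.exists_not_par_not_par x c
  obtain ⟨C, ⟨hC, hx, -⟩, -⟩ := L.joinCircle x c d hc hd' hd
  exact ⟨C, hC, hx⟩

theorem exists_par_ne (u : P) : ∃ v, L.Par u v ∧ v ≠ u := by
  obtain ⟨C, hC, -, hne⟩ := L.nontriv
  obtain ⟨q, hq⟩ := (Set.ne_univ_iff_exists_notMem C).1 hne
  obtain ⟨q', ⟨hqq', hq'⟩, -⟩ := L.parPoint q C hC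
  obtain ⟨D, hD, huD⟩ := L.exists_circle_mem u
  obtain ⟨q₁, hq₁, hq₁D⟩ : ∃ q₁, L.Par q q₁ ∧ q₁ ∉ D := by
    by_cases h : q ∈ D
    · exact ⟨q', hqq', fun h' => hq (eq_of_par hD h h' hqq' ▸ hq')⟩
    · exact ⟨q, L.par_refl q, h⟩
  obtain ⟨w, hwu, hwq⟩ := L.exists_not_par_not_par u q
  obtain ⟨v, ⟨hwv, hvD⟩, -⟩ := L.parPoint w D hD
  obtain ⟨E, ⟨hE, -, hDE⟩, -⟩ := L.touching D hD v hvD q₁ hq₁D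
    (fun h => hwq (hq₁.trans (hwv.trans h).symm))
  obtain ⟨u', ⟨huu', hu'⟩, -⟩ := L.parPoint u E hE
  refine ⟨u', huu', ?_⟩
  rintro rfl
  have : u' ∈ D ∩ E := ⟨huD, hu'⟩
  rw [hDE] at this
  exact hwu (by rw [Set.mem_singleton_iff.1 this]; exact hwv.symm)

theorem exists_par_notMem (u : P) {C : Set P} (hC : C ∈ L.Circles) : ∃ v, L.Par u v ∧ v ∉ C := by
  obtain ⟨v, huv, hne⟩ := L.exists_par_ne u
  by_cases h : u ∈ C
  · exact ⟨v, huv, fun h' => hne (eq_of_par hC h h' huv).symm⟩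
  · exact ⟨u, L.par_refl u, h⟩

variable {L}

/-- An automorphism fixing three generators pointwise is the identity. -/
theorem IsAut.eq_one {σ : Equiv.Perm P} (hσ : L.IsAut σ) {a b c : P}
    (hab : ¬ L.Par a b) (hbc : ¬ L.Par b c) (hac : ¬ L.Par a c)
    (ha : ∀ q, L.Par a q → σ q = q) (hb : ∀ q, L.Par b q → σ q = q)
    (hc : ∀ q, L.Par c q → σ q = q) : σ = 1 := by
  have himage : ∀ C ∈ L.Circles, ∀ x ∈ C, σ x ∈ C := by
    intro C hC x hx
    obtain ⟨a', ⟨haa, haC⟩, -⟩ := L.parPoint a C hC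
    obtain ⟨b', ⟨hbb, hbC⟩, -⟩ := L.parPoint b C hC
    obtain ⟨c', ⟨hcc, hcC⟩, -⟩ := L.parPoint c C hC
    have : C = σ '' C := by
      refine eq_of_three (a := a') (b := b') (c := c') hC ((hσ.1 C).1 hC) haC hbC hcC
        ⟨a', haC, ha a' haa⟩ ⟨b', hbC, hb b' hbb⟩ ⟨c', hcC, hc c' hcc⟩ ?_ ?_ ?_
      · rintro rfl; exact hab (haa.trans hbb.symm)
      · rintro rfl; exact hbc (hbb.trans hcc.symm)
      · rintro rfl; exact hac (haa.trans hcc.symm)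
    rw [this]
    exact ⟨x, hx, rfl⟩
  ext x
  obtain ⟨C, hC, hx⟩ := L.exists_circle_mem x
  obtain ⟨v, hv, -⟩ := L.exists_not_par_not_par x x
  obtain ⟨q, hvq, hq⟩ := L.exists_par_notMem v hC
  obtain ⟨E, ⟨hE, -, hCE⟩, -⟩ := L.touching C hC x hx q hq (fun h => hv (h.trans hvq.symm))
  have hxE : x ∈ C ∩ E := by rw [hCE]; rfl
  have : σ x ∈ C ∩ E := ⟨himage C hC x hx, himage E hE x hxE.2⟩
  rw [hCE] at this
  exact this

section Pencil

variable {p : P} {K : Set P}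

theorem mem_circles_of_mem_pencil (hK : K ∈ L.Circles) {C : Set P} (hC : C ∈ L.pencil p K) :
    C ∈ L.Circles := by
  rcases hC with rfl | hC
  exacts [hK, hC.1]

theorem mem_of_mem_pencil (hpK : p ∈ K) {C : Set P} (hC : C ∈ L.pencil p K) : p ∈ C := by
  rcases hC with rfl | hC
  · exact hpK
  · have : p ∈ C ∩ K := by rw [hC.2]; rfl
    exact this.1

theorem eq_of_mem_pencil (hK : K ∈ L.Circles) (hpK : p ∈ K) {C D : Set P}
    (hC : C ∈ L.pencil p K) (hD : D ∈ L.pencil p K) {z : P} (hzC : z ∈ C) (hzD : z ∈ D)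
    (hz : ¬ L.Par p z) : C = D := by
  have hzp : z ≠ p := by rintro rfl; exact hz (L.par_refl z)
  have tangent : ∀ C, C ∩ K = {p} → z ∈ C → z ∉ K := by
    intro C h h1 h2
    have : z ∈ C ∩ K := ⟨h1, h2⟩
    rw [h] at this
    exact hzp this
  rcases hC with rfl | hC <;> rcases hD with rfl | hD
  · rfl
  · exact absurd hzC (tangent D hD.2 hzD)
  · exact absurd hzD (tangent C hC.2 hzC)
  · exact (L.touching K hK p hpK z (tangent C hC.2 hzC) hz).unique
      ⟨hC.1, hzC, by rw [Set.inter_comm]; exact hC.2⟩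
      ⟨hD.1, hzD, by rw [Set.inter_comm]; exact hD.2⟩

theorem exists_mem_pencil (hK : K ∈ L.Circles) (hpK : p ∈ K) {z : P} (hz : ¬ L.Par p z) :
    ∃ C ∈ L.pencil p K, z ∈ C := by
  by_cases h : z ∈ K
  · exact ⟨K, Or.inl rfl, h⟩
  · obtain ⟨C, ⟨hC, hzC, hKC⟩, -⟩ := L.touching K hK p hpK z h hz
    exact ⟨C, Or.inr ⟨hC, by rw [Set.inter_comm]; exact hKC⟩, hzC⟩

end Pencil

/-- A group of automorphisms fixing the generator of `p` pointwise, leaving the pencil `⟨p,K⟩`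
invariant, transitive off the generator of `p` and satisfying the two-point condition on `K`. -/
structure IsPencilGroup (L : LaguerrePlane P) (p : P) (K : Set P)
    (Δ : Subgroup (Equiv.Perm P)) : Prop where
  circle : K ∈ L.Circles
  mem : p ∈ K
  aut : ∀ σ ∈ Δ, L.IsAut σ
  fix : ∀ σ ∈ Δ, ∀ q, L.Par p q → σ q = q
  pen : ∀ σ ∈ Δ, ∀ M ∈ L.pencil p K, ⇑σ '' M ∈ L.pencil p K
  trans : ∀ x y : P, ¬ L.Par p x → ¬ L.Par p y → ∃ σ ∈ Δ, σ x = y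
  stab : ∀ r ∈ K, r ≠ p → ∀ x ∈ K, x ≠ p → x ≠ r → ∀ y ∈ K, y ≠ p → y ≠ r →
    ∃ σ ∈ Δ, σ r = r ∧ σ x = y

namespace IsPencilGroup

variable {p : P} {K : Set P} {Δ : Subgroup (Equiv.Perm P)} (h : L.IsPencilGroup p K Δ)
include h

theorem not_par_apply {σ : Equiv.Perm P} (hσ : σ ∈ Δ) {x : P} (hx : ¬ L.Par p x) :
    ¬ L.Par p (σ x) := by
  intro hp
  rw [← h.fix σ hσ p (L.par_refl p)] at hp
  exact hx (((h.aut σ hσ).2 p x).2 hp)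

theorem image_eq {σ : Equiv.Perm P} (hσ : σ ∈ Δ) {C D : Set P} (hC : C ∈ L.pencil p K)
    (hD : D ∈ L.pencil p K) {x : P} (hx : ¬ L.Par p x) (hxC : x ∈ C) (hxD : σ x ∈ D) :
    σ '' C = D :=
  eq_of_mem_pencil h.circle h.mem (h.pen σ hσ C hC) hD ⟨x, hxC, rfl⟩ hxD (h.not_par_apply hσ hx)

theorem apply_mem {σ : Equiv.Perm P} (hσ : σ ∈ Δ) {C D : Set P} (hC : C ∈ L.pencil p K)
    (hD : D ∈ L.pencil p K) {x : P} (hx : ¬ L.Par p x) (hxC : x ∈ C) (hxD : σ x ∈ D)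
    {y : P} (hy : y ∈ C) : σ y ∈ D := by
  rw [← h.image_eq hσ hC hD hx hxC hxD]
  exact ⟨y, hy, rfl⟩

theorem not_par_of_ne {C : Set P} (hC : C ∈ L.pencil p K) {x : P} (hx : x ∈ C) (hxp : x ≠ p) :
    ¬ L.Par p x := fun hp =>
  hxp (eq_of_par (mem_circles_of_mem_pencil h.circle hC) (mem_of_mem_pencil h.mem hC) hx hp).symm

theorem exists_fix_apply_eq {C : Set P} (hC : C ∈ L.pencil p K) {r x y : P} (hr : r ∈ C)
    (hrp : r ≠ p) (hx : x ∈ C) (hxp : x ≠ p) (hxr : x ≠ r) (hy : y ∈ C) (hyp : y ≠ p)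
    (hyr : y ≠ r) : ∃ σ ∈ Δ, σ r = r ∧ σ x = y := by
  have hr' := h.not_par_of_ne hC hr hrp
  obtain ⟨k, ⟨hrk, hk⟩, -⟩ := L.parPoint r K h.circle
  obtain ⟨τ, hτ, rfl⟩ := h.trans r k hr' (fun hp => hr' (hp.trans hrk.symm))
  have hKK : K ∈ L.pencil p K := Or.inl rfl
  have hp := h.fix τ hτ p (L.par_refl p)
  have ne : ∀ z, z ≠ p → τ z ≠ p := fun z hz hz' => hz (τ.injective (hz'.trans hp.symm))
  have mem : ∀ z, z ∈ C → τ z ∈ K := fun z hz => h.apply_mem hτ hC hKK hr' hr hk hz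
  obtain ⟨σ, hσ, h1, h2⟩ := h.stab (τ r) hk (ne r hrp) (τ x) (mem x hx) (ne x hxp)
    (τ.injective.ne hxr) (τ y) (mem y hy) (ne y hyp) (τ.injective.ne hyr)
  exact ⟨τ⁻¹ * σ * τ, Δ.mul_mem (Δ.mul_mem (Δ.inv_mem hτ) hσ) hτ, by simp [h1], by simp [h2]⟩

theorem image_eq_of_mem_pencil {C : Set P} (hC : C ∈ L.pencil p K) {r : P} (hr : r ∈ C)
    (hrp : ¬ L.Par p r) {σ : Equiv.Perm P} (hσ : σ ∈ Δ) (hσr : σ r = r) {M : Set P}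
    (hM : M ∈ L.pencil r C) : σ '' M = M := by
  have hσC : σ '' C = C := h.image_eq hσ hC hC hrp hr (by rwa [hσr])
  have hC' := mem_circles_of_mem_pencil h.circle hC
  have hpC := mem_of_mem_pencil h.mem hC
  rcases hM with rfl | ⟨hM, hMC⟩
  · exact hσC
  obtain ⟨q, ⟨hpq, hq⟩, -⟩ := L.parPoint p M hM
  have hqC : q ∉ C := by
    intro hqC
    have : q ∈ M ∩ C := ⟨hq, hqC⟩
    rw [hMC] at this
    exact hrp (by rwa [Set.mem_singleton_iff.1 this] at hpq)
  refine (L.touching C hC' r hr q hqC (fun h' => hrp (hpq.trans h'.symm))).unique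
    ⟨((h.aut σ hσ).1 M).1 hM, ⟨q, hq, h.fix σ hσ q hpq⟩, ?_⟩
    ⟨hM, hq, by rw [Set.inter_comm]; exact hMC⟩
  rw [Set.inter_comm]
  conv_lhs => rw [← hσC]
  rw [← Set.image_inter σ.injective, hMC, Set.image_singleton, hσr]

theorem exists_fix_apply_eq_of_mem_pencil {C : Set P} (hC : C ∈ L.pencil p K) {r : P}
    (hr : r ∈ C) (hrp : ¬ L.Par p r) {M : Set P} (hM : M ∈ L.pencil r C) {x y : P} (hx : x ∈ M)
    (hy : y ∈ M) (hxr : x ≠ r) (hyr : y ≠ r) (hxp : ¬ L.Par p x) (hyp : ¬ L.Par p y) :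
    ∃ σ ∈ Δ, σ r = r ∧ σ x = y := by
  have hC' := mem_circles_of_mem_pencil h.circle hC
  have hM' := mem_circles_of_mem_pencil hC' hM
  have hrM := mem_of_mem_pencil hr hM
  obtain ⟨x', ⟨hxx, hx'⟩, -⟩ := L.parPoint x C hC'
  obtain ⟨y', ⟨hyy, hy'⟩, -⟩ := L.parPoint y C hC'
  obtain ⟨σ, hσ, h1, h2⟩ := h.exists_fix_apply_eq hC hr
    (by rintro rfl; exact hrp (L.par_refl _)) hx'
    (by rintro rfl; exact hxp hxx.symm) (by rintro rfl; exact hxr (eq_of_par hM' hx hrM hxx)) hy'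
    (by rintro rfl; exact hyp hyy.symm) (by rintro rfl; exact hyr (eq_of_par hM' hy hrM hyy))
  refine ⟨σ, hσ, h1, eq_of_par hM' ?_ hy ?_⟩
  · rw [← h.image_eq_of_mem_pencil hC hr hrp hσ h1 hM]
    exact ⟨x, hx, rfl⟩
  · have := ((h.aut σ hσ).2 x x').1 hxx
    rw [h2] at this
    exact this.trans hyy.symm

/-- An element of the group fixing two points of a circle `C` of the pencil fixes the generator
of the second one pointwise. -/
theorem apply_eq_of_par {C : Set P} (hC : C ∈ L.pencil p K) {r a : P} (hr : r ∈ C)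
    (hrp : ¬ L.Par p r) (ha : a ∈ C) (hra : r ≠ a) {σ : Equiv.Perm P} (hσ : σ ∈ Δ)
    (hσr : σ r = r) (hσa : σ a = a) {u : P} (hu : L.Par a u) : σ u = u := by
  have hC' := mem_circles_of_mem_pencil h.circle hC
  by_cases huC : u ∈ C
  · rwa [← eq_of_par hC' ha huC hu]
  obtain ⟨M, ⟨hM, huM, hCM⟩, -⟩ := L.touching C hC' r hr u huC
    (fun h' => hra (eq_of_par hC' hr ha (h'.trans hu.symm)))
  refine eq_of_par hM ?_ huM ?_
  · rw [← h.image_eq_of_mem_pencil hC hr hrp hσ hσr (Or.inr ⟨hM, by rwa [Set.inter_comm]⟩)]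
    exact ⟨u, huM, rfl⟩
  · have := ((h.aut σ hσ).2 a u).1 hu
    rw [hσa] at this
    exact this.symm.trans hu

theorem eq_one {C : Set P} (hC : C ∈ L.pencil p K) {r a : P} (hr : r ∈ C) (hrp : r ≠ p)
    (ha : a ∈ C) (hap : a ≠ p) (hra : r ≠ a) {σ : Equiv.Perm P} (hσ : σ ∈ Δ)
    (hσr : σ r = r) (hσa : σ a = a) : σ = 1 := by
  have hC' := mem_circles_of_mem_pencil h.circle hC
  have hrp' := h.not_par_of_ne hC hr hrp
  have hap' := h.not_par_of_ne hC ha hap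
  exact (h.aut σ hσ).eq_one hrp' (fun h' => hra (eq_of_par hC' hr ha h')) hap' (h.fix σ hσ)
    (fun _ => h.apply_eq_of_par hC ha hap' hr hra.symm hσ hσa hσr)
    (fun _ => h.apply_eq_of_par hC hr hrp' ha hra hσ hσr hσa)

theorem exists_mem_ne {C : Set P} (hC : C ∈ L.pencil p K) (r : P) :
    ∃ x ∈ C, x ≠ p ∧ ¬ L.Par r x := by
  obtain ⟨w, hpw, hrw⟩ := L.exists_not_par_not_par p r
  obtain ⟨x, ⟨hwx, hx⟩, -⟩ := L.parPoint w C (mem_circles_of_mem_pencil h.circle hC)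
  exact ⟨x, hx, by rintro rfl; exact hpw hwx.symm, fun h' => hrw (h'.trans hwx.symm)⟩

/-- The stabilizer of a point off the generator of `p` contains at most one involution. -/
theorem involution_unique {r : P} (hrp : ¬ L.Par p r) {σ τ : Equiv.Perm P} (hσ : σ ∈ Δ)
    (hτ : τ ∈ Δ) (hσ1 : σ ≠ 1) (hτ1 : τ ≠ 1) (hσσ : σ * σ = 1) (hττ : τ * τ = 1)
    (hσr : σ r = r) (hτr : τ r = r) : σ = τ := by
  obtain ⟨C, hC, hr⟩ := exists_mem_pencil h.circle h.mem hrp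
  have hrp' : r ≠ p := by rintro rfl; exact hrp (L.par_refl _)
  obtain ⟨x, hx, hxp, hrx⟩ := h.exists_mem_ne hC r
  have hrx' : r ≠ x := by rintro rfl; exact hrx (L.par_refl _)
  have stable : ∀ ρ ∈ Δ, ρ ≠ 1 → ρ r = r → ρ x ∈ C ∧ ρ x ≠ p ∧ ρ x ≠ x := by
    intro ρ hρ hρ1 hρr
    refine ⟨h.apply_mem hρ hC hC hrp hr (by rwa [hρr]) hx, fun hh => hxp (ρ.injective ?_),
      fun hh => hρ1 (h.eq_one hC hr hrp' hx hxp hrx' hρ hρr hh)⟩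
    rw [hh, h.fix ρ hρ p (L.par_refl p)]
  obtain ⟨hσC, hσp, hσx⟩ := stable σ hσ hσ1 hσr
  obtain ⟨hτC, hτp, hτx⟩ := stable τ hτ hτ1 hτr
  obtain ⟨g, hg, hgx, hgσ⟩ := h.exists_fix_apply_eq hC hx hxp hσC hσp hσx hτC hτp hτx
  have hσσ' : ∀ z, σ (σ z) = z := fun z => by rw [← Equiv.Perm.mul_apply, hσσ]; rfl
  have hττ' : ∀ z, τ (τ z) = z := fun z => by rw [← Equiv.Perm.mul_apply, hττ]; rfl
  have hgx' : g⁻¹ x = x := by rw [Equiv.Perm.inv_eq_iff_eq, hgx]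
  have hgτ' : g⁻¹ (τ x) = σ x := by rw [Equiv.Perm.inv_eq_iff_eq, hgσ]
  have hconj : g * σ * g⁻¹ * τ = 1 := by
    refine h.eq_one hC hx hxp hτC hτp hτx.symm
      (Δ.mul_mem (Δ.mul_mem (Δ.mul_mem hg hσ) (Δ.inv_mem hg)) hτ) ?_ ?_
    · simp only [Equiv.Perm.mul_apply, hgτ', hσσ', hgx]
    · simp only [Equiv.Perm.mul_apply, hττ', hgx', hgσ]
  have hcomm : τ * g = g * σ := by
    have : g * σ * g⁻¹ = τ := by
      rw [mul_eq_one_iff_eq_inv] at hconj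
      rw [hconj, mul_eq_one_iff_inv_eq.1 hττ]
    rw [← this]; group
  have hτg : τ (g r) = g r := by
    rw [← Equiv.Perm.mul_apply, hcomm, Equiv.Perm.mul_apply, hσr]
  have hgrC : g r ∈ C :=
    h.apply_mem hg hC hC (h.not_par_of_ne hC hx hxp) hx (by rwa [hgx]) hr
  have hgr : g r = r := by
    by_contra hne
    refine hτ1 (h.eq_one hC hr hrp' hgrC (fun hh => hrp' (g.injective ?_)) (Ne.symm hne) hτ hτr hτg)
    rw [hh, h.fix g hg p (L.par_refl p)]
  have hg1 := h.eq_one hC hr hrp' hx hxp hrx' hg hgr hgx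
  rw [hg1, mul_one, one_mul] at hcomm
  exact hcomm.symm

theorem exists_involution
    (hA3 : ∀ M ∈ L.Circles, p ∉ M → ∃! N, N ∈ L.pencil p K ∧ ∃ z, M ∩ N = {z})
    {r s : P} (hrp : ¬ L.Par p r) (hrs : L.Par r s) (hne : s ≠ r) :
    ∃ σ ∈ Δ, σ ≠ 1 ∧ σ * σ = 1 ∧ σ r = r ∧ σ s = s := by
  obtain ⟨C, hC, hr⟩ := exists_mem_pencil h.circle h.mem hrp
  have hC' := mem_circles_of_mem_pencil h.circle hC
  have hpC := mem_of_mem_pencil h.mem hC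
  have hrp' : r ≠ p := by rintro rfl; exact hrp (L.par_refl _)
  have hsp : ¬ L.Par p s := fun h' => hrp (h'.trans hrs.symm)
  obtain ⟨N, hN, hsN⟩ := exists_mem_pencil h.circle h.mem hsp
  have hN' := mem_circles_of_mem_pencil h.circle hN
  have hpN := mem_of_mem_pencil h.mem hN
  have hNC : N ≠ C := by
    rintro rfl; exact hne (eq_of_par hC' hr hsN hrs).symm
  have hrN : r ∉ N := fun hrN => hne (eq_of_par hN' hsN hrN hrs.symm)
  obtain ⟨a, haN, hap, hra⟩ := h.exists_mem_ne hN r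
  have hap' := h.not_par_of_ne hN haN hap
  have haC : a ∉ C := fun haC => hNC (eq_of_mem_pencil h.circle h.mem hN hC haN haC hap')
  obtain ⟨M, ⟨hM, haM, hCM⟩, -⟩ := L.touching C hC' r hr a haC hra
  have hpM : p ∉ M := by
    intro hpM
    have : p ∈ C ∩ M := ⟨hpC, hpM⟩
    rw [hCM] at this
    exact hrp' this.symm
  have hMC : M ∩ C = {r} := by rwa [Set.inter_comm]
  have hMpen : M ∈ L.pencil r C := Or.inr ⟨hM, hMC⟩
  obtain ⟨b, hbM, hbN, hab⟩ : ∃ b, b ∈ M ∧ b ∈ N ∧ a ≠ b := by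
    by_contra! H
    refine hNC ((hA3 M hM hpM).unique ⟨hN, a, ?_⟩ ⟨hC, r, hMC⟩)
    ext b
    exact ⟨fun hb => (H b hb.1 hb.2).symm, by rintro rfl; exact ⟨haM, haN⟩⟩
  have hbp' : ¬ L.Par p b :=
    h.not_par_of_ne hN hbN (by rintro rfl; exact hpM hbM)
  obtain ⟨σ, hσ, hσr, hσa⟩ := h.exists_fix_apply_eq_of_mem_pencil hC hr hrp hMpen haM hbM
    (by rintro rfl; exact hrN haN) (by rintro rfl; exact hrN hbN) hap' hbp'
  have hσN : ∀ z ∈ N, σ z ∈ N := fun z hz =>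
    h.apply_mem hσ hN hN hap' haN (by rwa [hσa]) hz
  have hσb : σ b = a := by
    have hσbM : σ b ∈ M := by
      rw [← h.image_eq_of_mem_pencil hC hr hrp hσ hσr hMpen]
      exact ⟨b, hbM, rfl⟩
    by_contra hba
    have : M = N := eq_of_three hM hN' haM hbM hσbM haN hbN (hσN b hbN) hab
      (fun hh => hab (σ.injective (hσa.trans hh))) (Ne.symm hba)
    exact hpM (this ▸ hpN)
  have hσs : σ s = s := by
    refine eq_of_par hN' (hσN s hsN) hsN ?_
    have := ((h.aut σ hσ).2 r s).1 hrs
    rw [hσr] at this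
    exact this.symm.trans hrs
  have hsp' : s ≠ p := by rintro rfl; exact hsp (L.par_refl _)
  refine ⟨σ, hσ, ?_, ?_, hσr, hσs⟩
  · rintro rfl; exact hab hσa
  · refine h.eq_one hN haN hap hsN hsp' (by rintro rfl; exact hra hrs) (Δ.mul_mem hσ hσ) ?_ ?_
    · rw [Equiv.Perm.mul_apply, hσa, hσb]
    · rw [Equiv.Perm.mul_apply, hσs, hσs]

end IsPencilGroup

end LaguerrePlane

/-- assume (A3).  Let r ∈ P ∖ p̄ and let C be the unique circle of
⟨p,K⟩ containing r.  Then (i) every σ ∈ Δ fixing r maps every circle of ⟨r,C⟩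
onto itself; (ii) the stabilizer of r is circular transitive on each circle of
⟨r,C⟩; (iii) Δ contains an involution fixing r̄ and p̄ pointwise and mapping K
onto itself. -/
theorem stabilizer_is_strain_group
    {P : Type*} (L : LaguerrePlane P) (p : P) (K : Set P)
    (Δ : Subgroup (Equiv.Perm P))
    (hK : K ∈ L.Circles) (hpK : p ∈ K)
    (haut : ∀ σ ∈ Δ, L.IsAut σ)
    (hfix : ∀ σ ∈ Δ, ∀ q, L.Par p q → σ q = q)
    (hpen : ∀ σ ∈ Δ, ∀ M ∈ L.pencil p K, ⇑σ '' M ∈ L.pencil p K)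
    (hA1 : ∀ x y : P, ¬ L.Par p x → ¬ L.Par p y → ∃ σ ∈ Δ, σ x = y)
    (hA2 : ∀ r ∈ K, r ≠ p → ∀ x ∈ K, x ≠ p → x ≠ r → ∀ y ∈ K, y ≠ p → y ≠ r →
      ∃ σ ∈ Δ, σ r = r ∧ σ x = y)    (hA3 : ∀ M ∈ L.Circles, p ∉ M → ∃! N, N ∈ L.pencil p K ∧ ∃ z, M ∩ N = {z})    :
    ∀ r : P, ¬ L.Par p r → ∀ C ∈ L.pencil p K, r ∈ C →
    ((∀ σ ∈ Δ, σ r = r → ∀ M ∈ L.pencil r C, ⇑σ '' M = M) ∧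
     (∀ M ∈ L.pencil r C, ∀ x ∈ M, ∀ y ∈ M, x ≠ r → y ≠ r →
        ¬ L.Par p x → ¬ L.Par p y → ∃ σ ∈ Δ, σ r = r ∧ σ x = y) ∧
     (∃ σ ∈ Δ, σ ≠ 1 ∧ σ * σ = 1 ∧ σ r = r ∧
        (∀ q, L.Par r q → σ q = q) ∧ (∀ q, L.Par p q → σ q = q) ∧
        ⇑σ '' K = K)) := by
  intro r hr C hC hrC
  have h : L.IsPencilGroup p K Δ := ⟨hK, hpK, haut, hfix, hpen, hA1, hA2⟩
  refine ⟨fun σ hσ hσr M hM => h.image_eq_of_mem_pencil hC hrC hr hσ hσr hM,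
    fun M hM x hx y hy hxr hyr hxp hyp =>
      h.exists_fix_apply_eq_of_mem_pencil hC hrC hr hM hx hy hxr hyr hxp hyp, ?_⟩
  obtain ⟨s, hrs, hne⟩ := L.exists_par_ne r
  obtain ⟨σ, hσ, hσ1, hσσ, hσr, -⟩ := h.exists_involution hA3 hr hrs hne
  have hgen : ∀ q, L.Par r q → σ q = q := by
    intro q hq
    by_cases hqr : q = r
    · rw [hqr, hσr]
    obtain ⟨τ, hτ, hτ1, hττ, hτr, hτq⟩ := h.exists_involution hA3 hr hq hqr
    rwa [h.involution_unique hr hσ hτ hσ1 hτ1 hσσ hττ hσr hτr]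
  obtain ⟨k, ⟨hrk, hk⟩, -⟩ := L.parPoint r K hK
  exact ⟨σ, hσ, hσ1, hσσ, hσr, hgen, hfix σ hσ, h.image_eq hσ (Or.inl rfl) (Or.inl rfl)
    (fun h' => hr (h'.trans hrk.symm)) hk (by rwa [hgen k hrk])⟩
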